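/- arXiv:2603.26508 — 4 statements merged into one kernel-verified Lean document; each statement's English description precedes it below -/
import Mathlib

section
/- Let 𝕊 be a commutative semiring and let G be a set equipped with an operation · : G × G → 𝕊G, where 𝕊G denotes the set of finitely supported functions from G to 𝕊 (formal sums Σ_{g∈G} s_g g, with (u)_j denoting the coefficient of j ∈ G in u ∈ 𝕊G). Assume: (1) g·h = h·g for all g,h ∈ G; (2) there exists e ∈ G such that e·g = g·e equals the single-term formal sum 1g for all g ∈ G; (3) for all g,h,i,k ∈ G one has Σ_{j∈G} (g·h)_j (j·i)_k = Σ_{j∈G} (h·i)_j (j·g)_k (all sums finite). Then 𝕊G is a commutative semiring under pointwise addition and the multiplication (Σ_g s_g g)(Σ_h t_h h) = Σ_{g,h} s_g t_h (g·h), with additive identity the zero function (which is also a multiplicative zero) and multiplicative identity 1e. Furthermore, if 𝕊 is a commutative ring then 𝕊G is a commutative ring. -/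
noncomputable section

/-- the multiplication of an arbitrary instance, usable without `letI` -/
def mulOf {X : Type*} (inst : CommSemiring X) : X → X → X := fun x y => (letI := inst; x * y)
def addOf {X : Type*} (inst : CommSemiring X) : X → X → X := fun x y => (letI := inst; x + y)
def oneOf {X : Type*} (inst : CommSemiring X) : X := (letI := inst; 1)
def zeroOf {X : Type*} (inst : CommSemiring X) : X := (letI := inst; 0)

def mulOfR {X : Type*} (inst : CommRing X) : X → X → X := fun x y => (letI := inst; x * y)
def addOfR {X : Type*} (inst : CommRing X) : X → X → X := fun x y => (letI := inst; x + y)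
def oneOfR {X : Type*} (inst : CommRing X) : X := (letI := inst; 1)
def zeroOfR {X : Type*} (inst : CommRing X) : X := (letI := inst; 0)

/-- The bilinear extension to formal sums of an operation on basis elements. -/
def bilinearExtension {S G : Type*} [CommSemiring S] (op : G → G → (G →₀ S)) :
    (G →₀ S) →ₗ[S] (G →₀ S) →ₗ[S] (G →₀ S) :=
  Finsupp.linearCombination S fun g => Finsupp.linearCombination S (op g)

section BilinearExtension

variable {S G : Type*} [CommSemiring S] {op : G → G → (G →₀ S)}

theorem bilinearExtension_apply (op : G → G → (G →₀ S)) (x y : G →₀ S) :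
    bilinearExtension op x y = x.sum fun g s => y.sum fun h t => (s * t) • op g h := by
  simp [bilinearExtension, Finsupp.linearCombination_apply, Finsupp.sum, Finset.smul_sum,
    mul_smul]

theorem bilinearExtension_single (op : G → G → (G →₀ S)) (g h : G) :
    bilinearExtension op (Finsupp.single g 1) (Finsupp.single h 1) = op g h := by
  simp [bilinearExtension]

theorem bilinearExtension_comm (hcomm : ∀ g h, op g h = op h g) (x y : G →₀ S) :
    bilinearExtension op x y = bilinearExtension op y x := by
  have : bilinearExtension op = (bilinearExtension op).flip := by
    ext g h : 4
    simpa [bilinearExtension_single] using hcomm g h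
  exact LinearMap.congr_fun₂ this x y

theorem bilinearExtension_single_left_one {e : G} (hid : ∀ g, op e g = Finsupp.single g 1)
    (x : G →₀ S) : bilinearExtension op (Finsupp.single e 1) x = x := by
  have : bilinearExtension op (Finsupp.single e 1) = LinearMap.id := by
    ext g : 2
    simpa [bilinearExtension_single] using hid g
  exact LinearMap.congr_fun this x

theorem bilinearExtension_apply_single_apply (op : G → G → (G →₀ S)) (x : G →₀ S) (i k : G) :
    bilinearExtension op x (Finsupp.single i 1) k = x.sum fun j c => c * op j i k := by
  rw [bilinearExtension, Finsupp.linearCombination_apply]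
  simp [Finsupp.sum]

theorem bilinearExtension_assoc (hcomm : ∀ g h, op g h = op h g)
    (hassoc : ∀ g h i k : G,
      ((op g h).sum fun j c => c * (op j i) k) = ((op h i).sum fun j c => c * (op j g) k))
    (x y z : G →₀ S) :
    bilinearExtension op (bilinearExtension op x y) z =
      bilinearExtension op x (bilinearExtension op y z) := by
  induction x using Finsupp.induction_linear with
  | zero => simp
  | add x x' hx hx' => simp [hx, hx']
  | single g a =>
  induction y using Finsupp.induction_linear with
  | zero => simp
  | add y y' hy hy' => simp [hy, hy']
  | single h b =>
  induction z using Finsupp.induction_linear with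
  | zero => simp
  | add z z' hz hz' => simp [hz, hz']
  | single i c =>
  rw [← Finsupp.smul_single_one g, ← Finsupp.smul_single_one h, ← Finsupp.smul_single_one i]
  simp only [map_smul, LinearMap.smul_apply, bilinearExtension_single]
  rw [bilinearExtension_comm hcomm (Finsupp.single g 1)]
  have key : bilinearExtension op (op g h) (Finsupp.single i 1) =
      bilinearExtension op (op h i) (Finsupp.single g 1) := by
    ext k
    simpa only [bilinearExtension_apply_single_apply] using hassoc g h i k
  rw [key]

end BilinearExtension

/-- The commutative semiring of formal sums over a set with a commutative, unital and
associative operation valued in formal sums. -/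
abbrev formalSumCommSemiring {S G : Type*} [CommSemiring S] (op : G → G → (G →₀ S)) (e : G)
    (hcomm : ∀ g h, op g h = op h g) (hid : ∀ g, op e g = Finsupp.single g 1)
    (hassoc : ∀ g h i k : G,
      ((op g h).sum fun j c => c * (op j i) k) = ((op h i).sum fun j c => c * (op j g) k)) :
    CommSemiring (G →₀ S) :=
  { Finsupp.instAddCommMonoid with
    mul := fun x y => bilinearExtension op x y
    one := Finsupp.single e 1
    left_distrib := fun x y z => map_add (bilinearExtension op x) y z
    right_distrib := fun x y z => LinearMap.map_add₂ (bilinearExtension op) x y z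
    zero_mul := fun x => LinearMap.map_zero₂ (bilinearExtension op) x
    mul_zero := fun x => map_zero (bilinearExtension op x)
    mul_assoc := bilinearExtension_assoc hcomm hassoc
    one_mul := bilinearExtension_single_left_one hid
    mul_one := fun x => (bilinearExtension_comm hcomm _ _).trans
      (bilinearExtension_single_left_one hid x)
    mul_comm := bilinearExtension_comm hcomm }

/-- Formal sums with coefficients in a commutative ring form a commutative ring. -/
abbrev formalSumCommRing {S G : Type*} [CommRing S] (op : G → G → (G →₀ S)) (e : G)
    (hcomm : ∀ g h, op g h = op h g) (hid : ∀ g, op e g = Finsupp.single g 1)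
    (hassoc : ∀ g h i k : G,
      ((op g h).sum fun j c => c * (op j i) k) = ((op h i).sum fun j c => c * (op j g) k)) :
    CommRing (G →₀ S) :=
  { formalSumCommSemiring op e hcomm hid hassoc, Finsupp.instAddCommGroup with }

/-- Theorem (semirings of formal sums): if `𝕊` is a commutative semiring and `G` is a set
with an operation `op : G × G → 𝕊G` (where `𝕊G = G →₀ 𝕊` is the set of formal sums, i.e.
finitely supported functions) which is commutative, has an identity basis element `e`
(`op e g = op g e = 1g`), and satisfies the associativity condition (3), then `𝕊G` is a
commutative semiring under pointwise addition and the convolution product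
`(Σ s_g g)(Σ t_h h) = Σ s_g t_h (op g h)`, with additive identity `0` (which is a
multiplicative zero) and multiplicative identity `1e`.  Furthermore, if `𝕊` is a
commutative ring, then `𝕊G` is a commutative ring. -/
theorem stmt0 {𝕊 : Type*} [instS : CommSemiring 𝕊] {G : Type*}
    (op : G → G → (G →₀ 𝕊)) (e : G)
    (hcomm : ∀ g h : G, op g h = op h g)
    (hid : ∀ g : G, op e g = Finsupp.single g 1 ∧ op g e = Finsupp.single g 1)
    (hassoc : ∀ g h i k : G,
      ((op g h).sum fun j c => c * (op j i) k) =
        ((op h i).sum fun j c => c * (op j g) k)) :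
    (∃ inst : CommSemiring (G →₀ 𝕊),
      (∀ x y : G →₀ 𝕊,
        mulOf inst x y = x.sum fun g s => y.sum fun h t => (s * t) • op g h) ∧
      (∀ x y : G →₀ 𝕊, addOf inst x y = x + y) ∧
      zeroOf inst = 0 ∧
      oneOf inst = Finsupp.single e 1 ∧
      (∀ x : G →₀ 𝕊, mulOf inst 0 x = 0 ∧ mulOf inst x 0 = 0)) ∧
    (∀ instR : CommRing 𝕊, instR.toCommSemiring = instS →
      ∃ instR' : CommRing (G →₀ 𝕊),
        (∀ x y : G →₀ 𝕊,
          mulOfR instR' x y = x.sum fun g s => y.sum fun h t => (s * t) • op g h) ∧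
        (∀ x y : G →₀ 𝕊, addOfR instR' x y = x + y) ∧
        zeroOfR instR' = 0 ∧
        oneOfR instR' = Finsupp.single e 1) := by
  refine ⟨⟨formalSumCommSemiring op e hcomm (fun g => (hid g).1) hassoc,
    bilinearExtension_apply op, fun _ _ => rfl, rfl, rfl, fun x =>
      ⟨LinearMap.map_zero₂ (bilinearExtension op) x, map_zero (bilinearExtension op x)⟩⟩, ?_⟩
  rintro instR rfl
  exact ⟨formalSumCommRing op e hcomm (fun g => (hid g).1) hassoc,
    bilinearExtension_apply op, fun _ _ => rfl, rfl, rfl⟩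

end
end

section
/- Let D be a finite lattice with greatest element ⊤. Then there exists a unique subset A ⊆ D such that ⊤ ∈ A and, for every m ∈ D with m ≠ ⊤, the number of elements d ∈ A with d ≥ m is even. -/
/-- The number of elements of `A` above `m` is even iff membership of `m` in `A` is the parity of
the number of elements of `A` strictly above `m`. -/
theorem even_ncard_sep_le_iff {D : Type*} [PartialOrder D] [Finite D] (A : Set D) (m : D) :
    Even {d ∈ A | m ≤ d}.ncard ↔ (m ∈ A ↔ ¬ Even {d ∈ A | m < d}.ncard) := by
  by_cases hm : m ∈ A
  · have h : {d ∈ A | m ≤ d} = insert m {d ∈ A | m < d} := by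
      ext d
      simp only [Set.mem_ofPred_eq, Set.mem_insert_iff, le_iff_eq_or_lt]
      grind
    rw [h, Set.ncard_insert_of_notMem (by simp), Nat.even_add_one]
    simp [hm]
  · have h : {d ∈ A | m ≤ d} = {d ∈ A | m < d} := by
      ext d
      simp only [Set.mem_ofPred_eq, le_iff_eq_or_lt]
      grind
    simp [h, hm]

/-- In a finite partial order, a set can be defined by prescribing the membership of `m` in terms
of the elements of the set strictly above `m`. -/
theorem existsUnique_set_mem_iff {D : Type*} [PartialOrder D] [Finite D]
    (F : D → Set D → Prop) :
    ∃! A : Set D, ∀ m, m ∈ A ↔ F m {d ∈ A | m < d} := by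
  have wf : WellFounded ((· > ·) : D → D → Prop) := wellFounded_gt
  let P : D → Prop := wf.fix fun m ih => F m {d | ∃ h : d > m, ih d h}
  have hP (m : D) : P m ↔ F m {d | P d ∧ m < d} := by
    have h := wf.fix_eq (fun m (ih : ∀ d, d > m → Prop) => F m {d | ∃ h : d > m, ih d h}) m
    refine (iff_of_eq h).trans (iff_of_eq (congrArg (F m) ?_))
    ext d
    exact exists_prop.trans and_comm
  refine ⟨{d | P d}, hP, fun B hB => Set.ext fun m => ?_⟩
  induction m using wf.induction with
  | _ m ih =>
    rw [hB m]
    refine Iff.trans (iff_of_eq (congrArg (F m) ?_)) (hP m).symm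
    ext d
    exact and_congr_left (ih d)

/-- Lemma: for any finite lattice `D` (with greatest element `⊤`), there is a unique
subset `A ⊆ D` such that `⊤ ∈ A` and, for every `m ≠ ⊤`, the number of elements of `A`
greater than or equal to `m` is even. -/
theorem stmt1 {D : Type*} [Lattice D] [Fintype D] [OrderTop D] :
    ∃! A : Set D, (⊤ : D) ∈ A ∧
      ∀ m : D, m ≠ ⊤ → Even {d ∈ A | m ≤ d}.ncard := by
  refine (existsUnique_congr fun A => ?_).mp
    (existsUnique_set_mem_iff fun (m : D) S => m = ⊤ ∨ ¬ Even S.ncard)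
  simp only [even_ncard_sep_le_iff]
  grind
end

section
/- The set of atoms of the Boolean algebra V(L) is exactly { a^l : l ∈ L }; in particular l ↦ a^l is a bijection from L onto the atoms of V(L), and a^l is the unique atom b with ⋁ b = l (the join in L of the elements of the subset b). -/
open Finsupp

noncomputable section

variable {L : Type*} [Lattice L] [Fintype L] [BoundedOrder L] [DecidableEq L] [DecidableRel ((· ≤ ·) : L → L → Prop)]

/-- the multiplication of `V(L) = F₂L`: the `F₂`-bilinear extension of the meet of `L` -/
def vmul (x y : L →₀ ZMod 2) : L →₀ ZMod 2 :=
  x.sum fun l a => y.sum fun m b => Finsupp.single (l ⊓ m) (a * b)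

/-- an atom of the Boolean algebra `V(L)`: a minimal nonzero element for the order
`x ≤ y` iff `x·y = x` -/
def IsVAtom (b : L →₀ ZMod 2) : Prop :=
  b ≠ 0 ∧ ∀ c : L →₀ ZMod 2, c ≠ 0 → vmul c b = c → c = b

/-- `b = aˡ`: `b` is a subset of the down-set of `l` which contains `l` and has an even
number of elements above each `m < l` -/
def IsAl (l : L) (b : L →₀ ZMod 2) : Prop :=
  (∀ d ∈ b.support, d ≤ l) ∧ b l = 1 ∧
    ∀ m : L, m < l → Even ((b.support.filter fun d => m ≤ d).card)

/-- The zeta transform on `F₂L`: its value at `m` is the number modulo `2` of elements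
above `m`. -/
def zeta : (L →₀ ZMod 2) →ₗ[ZMod 2] (L → ZMod 2) :=
  Finsupp.linearCombination (ZMod 2) fun d m => if m ≤ d then 1 else 0

theorem zeta_single (d : L) (a : ZMod 2) (m : L) :
    zeta (Finsupp.single d a) m = if m ≤ d then a else 0 := by
  simp [zeta, Finsupp.linearCombination_single]

theorem zeta_apply (x : L →₀ ZMod 2) (m : L) :
    zeta x m = ∑ d, if m ≤ d then x d else 0 := by
  rw [zeta, Finsupp.linearCombination_apply, Finsupp.sum_fintype _ _ (by simp)]
  simp [Finset.sum_apply]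

theorem zeta_eq_card (x : L →₀ ZMod 2) (m : L) :
    zeta x m = ((x.support.filter fun d => m ≤ d).card : ZMod 2) := by
  have key : ∀ a : ZMod 2, a = if a ≠ 0 then 1 else 0 := by decide
  rw [zeta_apply, Finset.card_filter, Nat.cast_sum, ← Finset.sum_subset x.support.subset_univ]
  · refine Finset.sum_congr rfl fun d hd => ?_
    have := key (x d)
    rw [if_pos (Finsupp.mem_support_iff.1 hd)] at this
    rw [this]
    split_ifs <;> simp
  · intro d _ hd
    simp [Finsupp.notMem_support_iff.1 hd]

theorem zeta_vmul (x y : L →₀ ZMod 2) : zeta (vmul x y) = zeta x * zeta y := by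
  induction x using Finsupp.induction_linear with
  | zero => simp [vmul]
  | add x x' hx hx' =>
    have : vmul (x + x') y = vmul x y + vmul x' y := by
      unfold vmul
      refine Finsupp.sum_add_index' (by simp) fun l a a' => ?_
      simp [add_mul, Finsupp.sum_add]
    rw [this, map_add, hx, hx', map_add, add_mul]
  | single l a =>
    induction y using Finsupp.induction_linear with
    | zero => simp [vmul]
    | add y y' hy hy' =>
      have : vmul (single l a) (y + y') = vmul (single l a) y + vmul (single l a) y' := by
        simp only [vmul, Finsupp.sum_single_index, zero_mul, Finsupp.single_zero,
          Finsupp.sum_fun_zero]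
        exact Finsupp.sum_add_index' (by simp) fun m b b' => by simp [mul_add]
      rw [this, map_add, hy, hy', map_add, mul_add]
    | single m b =>
      ext k
      have : vmul (single l a) (single m b) = single (l ⊓ m) (a * b) := by
        simp [vmul, Finsupp.sum_single_index]
      rw [this, Pi.mul_apply, zeta_single, zeta_single, zeta_single]
      by_cases h : k ≤ l <;> by_cases h' : k ≤ m <;> simp [h, h']

/-- If the zeta transform of `x` vanishes above `m`, then so does `x`. -/
theorem eq_zero_of_zeta_eq_zero (x : L →₀ ZMod 2) (m : L) (h : ∀ d, m ≤ d → zeta x d = 0) :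
    x m = 0 := by
  induction m using WellFoundedGT.induction with
  | ind m ih =>
    have hm := h m le_rfl
    rw [zeta_apply, Finset.sum_eq_single m] at hm
    · simpa using hm
    · intro d _ hd
      split_ifs with hmd
      · exact ih d (lt_of_le_of_ne hmd hd.symm) fun e he => h e (hmd.trans he)
      · rfl
    · simp

theorem zeta_injective : Function.Injective (zeta (L := L)) := by
  refine (injective_iff_map_eq_zero _).2 fun x hx => Finsupp.ext fun m => ?_
  exact eq_zero_of_zeta_eq_zero x m fun d _ => congrFun hx d

theorem zeta_surjective : Function.Surjective (zeta (L := L)) :=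
  (LinearMap.injective_iff_surjective_of_finrank_eq_finrank (by simp)).1 zeta_injective

theorem isAl_iff_zeta_eq (l : L) (b : L →₀ ZMod 2) : IsAl l b ↔ zeta b = Pi.single l 1 := by
  have eval_top (h : ∀ d ∈ b.support, d ≤ l) : zeta b l = b l := by
    rw [zeta_apply, Finset.sum_eq_single l]
    · simp
    · intro d _ hd
      split_ifs with hld
      · by_contra hne
        exact hd (le_antisymm (h d (Finsupp.mem_support_iff.2 hne)) hld)
      · rfl
    · simp
  constructor
  · rintro ⟨h₁, h₂, h₃⟩
    ext m
    by_cases hml : m = l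
    · subst hml
      rw [eval_top h₁, h₂, Pi.single_eq_same]
    rw [Pi.single_eq_of_ne hml]
    by_cases hle : m ≤ l
    · rw [zeta_eq_card, ZMod.natCast_eq_zero_iff_even]
      exact h₃ m (lt_of_le_of_ne hle hml)
    · rw [zeta_eq_card, Finset.filter_false_of_mem fun d hd hmd => hle (hmd.trans (h₁ d hd))]
      simp
  · intro h
    have hsupp : ∀ d ∈ b.support, d ≤ l := by
      intro d hd
      by_contra hdl
      refine Finsupp.mem_support_iff.1 hd (eq_zero_of_zeta_eq_zero b d fun e hde => ?_)
      rw [h, Pi.single_eq_of_ne]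
      rintro rfl
      exact hdl hde
    refine ⟨hsupp, ?_, fun m hm => ?_⟩
    · rw [← eval_top hsupp, h, Pi.single_eq_same]
    · rw [← ZMod.natCast_eq_zero_iff_even, ← zeta_eq_card, h, Pi.single_eq_of_ne hm.ne]

theorem isVAtom_iff_exists_isAl (b : L →₀ ZMod 2) : IsVAtom b ↔ ∃ l : L, IsAl l b := by
  have eq_one : ∀ a : ZMod 2, a ≠ 0 → a = 1 := by decide
  simp only [isAl_iff_zeta_eq]
  constructor
  · rintro ⟨hb, hmin⟩
    obtain ⟨l, hl⟩ : ∃ l, zeta b l ≠ 0 := by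
      by_contra! h
      exact hb (zeta_injective ((funext h).trans (map_zero zeta).symm))
    obtain ⟨c, hc⟩ := zeta_surjective (Pi.single l 1 : L → ZMod 2)
    refine ⟨l, ?_⟩
    rw [← hmin c ?_ ?_, hc]
    · rintro rfl
      simpa using congrFun hc l
    · apply zeta_injective
      rw [zeta_vmul, hc, ← Pi.single_mul_left, eq_one _ hl, mul_one]
  · rintro ⟨l, hl⟩
    refine ⟨?_, fun c hc hcb => zeta_injective ?_⟩
    · rintro rfl
      simpa using congrFun hl l
    · have hprod := congrArg zeta hcb
      rw [zeta_vmul, hl, ← Pi.single_mul_right, mul_one] at hprod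
      have hne : zeta c l ≠ 0 := by
        intro h
        rw [h, Pi.single_zero] at hprod
        exact hc (zeta_injective (hprod.symm.trans (map_zero zeta).symm))
      rw [← hprod, hl, eq_one _ hne]

theorem IsAl.support_sup_eq {l : L} {b : L →₀ ZMod 2} (h : IsAl l b) :
    b.support.sup id = l :=
  le_antisymm (Finset.sup_le h.1) <|
    Finset.le_sup (f := id) (Finsupp.mem_support_iff.2 (by simp [h.2.1]))

/-- The set of atoms of `V(L)` is exactly `{ aˡ : l ∈ L }`; moreover `⋁ aˡ = l`, and
`l ↦ aˡ` is a bijection onto the atoms: `aˡ` is the unique atom `b` with `⋁ b = l`. -/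
theorem stmt2 :
    (∀ b : L →₀ ZMod 2, IsVAtom b ↔ ∃ l : L, IsAl l b) ∧
    (∀ (l : L) (b : L →₀ ZMod 2), IsAl l b → b.support.sup id = l) ∧
    (∀ l : L, ∃! b : L →₀ ZMod 2, IsVAtom b ∧ b.support.sup id = l) := by
  refine ⟨isVAtom_iff_exists_isAl, fun l b => IsAl.support_sup_eq, fun l => ?_⟩
  obtain ⟨a, ha⟩ := zeta_surjective (Pi.single l 1 : L → ZMod 2)
  have haA := (isAl_iff_zeta_eq l a).2 ha
  refine ⟨a, ⟨(isVAtom_iff_exists_isAl a).2 ⟨l, haA⟩, haA.support_sup_eq⟩, ?_⟩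
  rintro b ⟨hb, rfl⟩
  obtain ⟨l, hl⟩ := (isVAtom_iff_exists_isAl b).1 hb
  rw [hl.support_sup_eq] at ha
  exact zeta_injective (((isAl_iff_zeta_eq l b).1 hl).trans ha.symm)

end
end

section
/- Let a, b ∈ L^{(1)} with a ≠ 0 and h = Height(a). Then x ∈ L^{(1)} satisfies ax = b if and only if b ≤ x·L_h and x·L_h ≤ b + a + L_h (order of L^{(1)}). -/
open Finsupp

noncomputable section

/-- `F₂L`: formal sums of chains, as finitely supported functions from the positive
integers (chain lengths) to `F₂` -/
abbrev T : Type := ℕ+ →₀ ZMod 2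

/-- multiplication of sums of odd chains: the `F₂`-bilinear extension of
`L_e · L_d = L_{min(d,e)}` -/
def lmul (x y : T) : T := x.sum fun m a => y.sum fun n b => Finsupp.single (min m n) (a * b)

/-- membership in `L⁽¹⁾`: all chain lengths in the support are odd -/
def OddSupp (x : T) : Prop := ∀ q ∈ x.support, Odd (q : ℕ)

/-- `Height(a)`: the largest chain length in the support (`Height 0 = 0`) -/
def height (x : T) : ℕ := x.support.sup fun q => (q : ℕ)

/-- the chain `L_n` (with `L_0 = 0`) -/
def chain (n : ℕ) : T := if h : 0 < n then Finsupp.single (⟨n, h⟩ : ℕ+) 1 else 0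

theorem lmul_single_single (m n : ℕ+) (r s : ZMod 2) :
    lmul (single m r) (single n s) = single (min m n) (r * s) := by
  simp [lmul]

theorem zero_lmul (x : T) : lmul 0 x = 0 := by
  simp [lmul]

theorem lmul_zero (x : T) : lmul x 0 = 0 := by
  simp [lmul]

theorem add_lmul (x y z : T) : lmul (x + y) z = lmul x z + lmul y z := by
  unfold lmul
  refine sum_add_index' (fun m => ?_) (fun m r s => ?_)
  · simp
  · simp only [add_mul, single_add, sum_add]

theorem lmul_add (x y z : T) : lmul x (y + z) = lmul x y + lmul x z := by
  unfold lmul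
  rw [← sum_add]
  refine sum_congr fun m _ => sum_add_index' (fun n => ?_) (fun n r s => ?_)
  · simp
  · rw [mul_add, single_add]

theorem lmul_comm (x y : T) : lmul x y = lmul y x := by
  induction x using Finsupp.induction_linear with
  | zero => rw [zero_lmul, lmul_zero]
  | add x₁ x₂ h₁ h₂ => rw [add_lmul, lmul_add, h₁, h₂]
  | single m r =>
    induction y using Finsupp.induction_linear with
    | zero => rw [zero_lmul, lmul_zero]
    | add y₁ y₂ h₁ h₂ => rw [add_lmul, lmul_add, h₁, h₂]
    | single n s => rw [lmul_single_single, lmul_single_single, min_comm, mul_comm]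

theorem lmul_assoc (x y z : T) : lmul (lmul x y) z = lmul x (lmul y z) := by
  induction x using Finsupp.induction_linear with
  | zero => simp only [zero_lmul]
  | add x₁ x₂ h₁ h₂ => simp only [add_lmul, h₁, h₂]
  | single m r =>
    induction y using Finsupp.induction_linear with
    | zero => simp only [zero_lmul, lmul_zero]
    | add y₁ y₂ h₁ h₂ => simp only [add_lmul, lmul_add, h₁, h₂]
    | single n s =>
      induction z using Finsupp.induction_linear with
      | zero => simp only [lmul_zero]
      | add z₁ z₂ h₁ h₂ => simp only [lmul_add, h₁, h₂]
      | single k t => simp only [lmul_single_single, min_assoc, mul_assoc]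

theorem add_self_eq_zero_of_zmod_two (x : T) : x + x = 0 := by
  ext n
  exact CharTwo.add_self_eq_zero (x n)

theorem lmul_self (x : T) : lmul x x = x := by
  induction x using Finsupp.induction_linear with
  | zero => exact zero_lmul 0
  | add x y hx hy =>
    rw [add_lmul, lmul_add, lmul_add, hx, hy, lmul_comm y x, add_assoc,
      ← add_assoc (lmul x y), add_self_eq_zero_of_zmod_two, zero_add]
  | single m r =>
    rw [lmul_single_single, min_self]
    congr 1
    revert r
    decide

theorem lmul_chain_height (a : T) : lmul a (chain (height a)) = a := by
  conv_rhs => rw [← sum_single a]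
  refine sum_congr fun m hm => ?_
  have hle : (m : ℕ) ≤ height a := Finset.le_sup (f := fun q : ℕ+ => (q : ℕ)) hm
  have hpos : 0 < height a := m.pos.trans_le hle
  have hmin : min m ⟨height a, hpos⟩ = m := min_eq_left hle
  rw [chain, dif_pos hpos]
  refine (sum_single_index (by simp)).trans ?_
  rw [hmin, mul_one]

/-- Division of sums of odd chains: for `a ≠ 0` of height `h`, `x` solves `a·x = b`
iff `b ≤ x·L_h ≤ b + a + L_h`, where `u ≤ v` iff `u·v = u`. -/
theorem stmt18 (a b : T) (ha : OddSupp a) (hb : OddSupp b) (ha0 : a ≠ 0) :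
    ∀ x : T, OddSupp x →
      (lmul a x = b ↔
        (lmul b (lmul x (chain (height a))) = b ∧
          lmul (lmul x (chain (height a))) (b + a + chain (height a)) =
            lmul x (chain (height a)))) := by
  intro x _
  have hy : lmul (lmul x (chain (height a))) a = lmul a x := by
    rw [lmul_assoc, lmul_comm _ a, lmul_chain_height, lmul_comm]
  have hyy : lmul (lmul x (chain (height a))) (chain (height a)) =
      lmul x (chain (height a)) := by
    rw [lmul_assoc, lmul_self]
  rw [lmul_add, lmul_add, hy, hyy, add_eq_right, lmul_comm _ b]
  constructor
  · rintro rfl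
    have hb : lmul (lmul a x) (lmul x (chain (height a))) = lmul a x := by
      rw [lmul_assoc, ← lmul_assoc x, lmul_self, lmul_comm x, ← lmul_assoc, lmul_chain_height]
    exact ⟨hb, by rw [hb, add_self_eq_zero_of_zmod_two]⟩
  · rintro ⟨h₁, h₂⟩
    rw [h₁] at h₂
    rw [← zero_add (lmul a x), ← add_self_eq_zero_of_zmod_two b, add_assoc, h₂, add_zero]

end
end
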